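/- arXiv:2503.20155 — 2 statements merged into one kernel-verified Lean document; each statement's English description precedes it below -/
import Mathlib

section
/- Let m > n be positive integers. Then ∑_{P ∈ D_{m,n}} p^{run(P)} q^{ret(P)} = ∑_{P ∈ D_{m,n}} p^{ret(P)} q^{run(P)} as polynomials in the indeterminates p and q. -/
open scoped Classical

namespace RationalDyck

/-- A lattice path: `true` = a north step `N`, `false` = an east step `E`. -/
abbrev Path : Type := List Bool

/-- The rank of the endpoint of a path prefix `Q` in the `m × n` grid:
`rank(i,j) = j*m - i*n`, where `i` is the number of east steps of `Q`
and `j` the number of north steps of `Q`. -/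
def prefRank (m n : ℕ) (Q : Path) : ℤ :=
  (Q.count true : ℤ) * m - (Q.count false : ℤ) * n

/-- `P` is an `m × n` rational Dyck path: it goes from `(0,0)` to `(m,n)` and
stays weakly above the line `y = n x / m`. -/
def IsDyck (m n : ℕ) (P : Path) : Prop :=
  P.count false = m ∧ P.count true = n ∧ ∀ i ≤ P.length, 0 ≤ prefRank m n (P.take i)

/-- The return statistic: the number of lattice points on `P` other than `(m,n)`
whose rank is strictly less than `n`. -/
def retStat (m n : ℕ) (P : Path) : ℕ :=
  ((List.range P.length).filter fun i => prefRank m n (P.take i) < (n : ℤ)).length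

/-- The coarea sequence of `P`: for each north step (from bottom to top), the number
of cells of the rectangle strictly to its left, i.e. the number of east steps before it. -/
def coarea (P : Path) : List ℕ :=
  (List.range P.length).filterMap fun i =>
    if P.getD i false = true then some ((P.take i).count false) else none

/-- The run statistic: the least `i ∈ [n]` not appearing in the coarea sequence. -/
noncomputable def runStat (P : Path) : ℕ :=
  sInf {i : ℕ | 1 ≤ i ∧ i ≤ P.count true ∧ i ∉ coarea P}

/-- The ratio-run statistic: with `k = ⌊m/n⌋`, the least `i ∈ [n]` such that `k*i`
does not appear in the coarea sequence. -/
noncomputable def ratioRun (m n : ℕ) (P : Path) : ℕ :=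
  sInf {i : ℕ | 1 ≤ i ∧ i ≤ P.count true ∧ (m / n) * i ∉ coarea P}

/-- The composition type of `P`: the lengths of the maximal blocks of consecutive
north steps, read from start to end. -/
def compType (P : Path) : List ℕ :=
  ((P.splitOn false).map List.length).filter fun x => x ≠ 0

/-- The number of maximal blocks of consecutive north steps (vertical components). -/
def nc (P : Path) : ℕ := (compType P).length

/-- `α` is a (strong) composition of `n`. -/
def IsComposition (n : ℕ) (α : List ℕ) : Prop :=
  (∀ a ∈ α, 0 < a) ∧ α.sum = n

/-- The finite set of all `m × n` rational Dyck paths. -/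
noncomputable def dyckPaths (m n : ℕ) : Finset Path :=
  ((Finset.univ : Finset (Fin (m + n) → Bool)).image List.ofFn).filter fun P => IsDyck m n P

/-- The `m × n` rational Dyck paths of composition type `α`. -/
noncomputable def dyckPathsComp (m n : ℕ) (α : List ℕ) : Finset Path :=
  (dyckPaths m n).filter fun P => compType P = α

/-- The `m × n` rational Dyck paths with `run = k` and `ret = l`. -/
noncomputable def dyckPathsRR (m n k l : ℕ) : Finset Path :=
  (dyckPaths m n).filter fun P => runStat P = k ∧ retStat m n P = l

/-- The `m × n` rational Dyck paths of composition type `α` with `run = k` and `ret = l`. -/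
noncomputable def dyckPathsCompRR (m n : ℕ) (α : List ℕ) (k l : ℕ) : Finset Path :=
  (dyckPathsComp m n α).filter fun P => runStat P = k ∧ retStat m n P = l

/-- The number of initial parts of `α` equal to `1`. -/
def iones (α : List ℕ) : ℕ := (α.takeWhile fun a => a = 1).length

/-- `rr(α, m) = min(Iones(α) + 1, ⌈n/(m-n)⌉)` where `n = |α|` is the sum of parts. -/
def rr (m : ℕ) (α : List ℕ) : ℕ :=
  min (iones α + 1) ((α.sum + (m - α.sum) - 1) / (m - α.sum))


/-- The rank `j * m - i * n` of the lattice point `(i, j)`. -/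
def rank (m n i j : ℕ) : ℤ := (j : ℤ) * m - (i : ℤ) * n

/-- `w` leads from `(i, j)` to `(m, n)` and stays weakly above the diagonal. -/
def IsDyckFrom (m n i j : ℕ) (w : Path) : Prop :=
  i + w.count false = m ∧ j + w.count true = n ∧
    ∀ k ≤ w.length, 0 ≤ rank m n i j + prefRank m n (w.take k)

/-- The number of lattice points of rank less than `n`, the last point excluded, on the
path `w` started at `(i, j)`. -/
def retFrom (m n i j : ℕ) (w : Path) : ℕ :=
  ((List.range w.length).filter fun k =>
    rank m n i j + prefRank m n (w.take k) < (n : ℤ)).length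

/-- The number of consecutive columns, from the current one on, that contain a north step.
The flag tells whether the current column is fresh; otherwise it is not counted, since a
north step in it has been taken already. -/
def runFrom : Bool → Path → ℕ
  | _, [] => 0
  | true, true :: w => runFrom false w + 1
  | true, false :: _ => 0
  | false, true :: w => runFrom false w
  | false, false :: w => runFrom true w

section Rank

variable {m n i j : ℕ}

lemma rank_succ_right : rank m n i (j + 1) = rank m n i j + m := by
  simp only [rank]; push_cast; ring

lemma rank_succ_left : rank m n (i + 1) j = rank m n i j - n := by
  simp only [rank]; push_cast; ring

lemma lt_of_rank_nonneg (hj : j < n) (h : 0 ≤ rank m n i j) (hm : 0 < m) : i < m := by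
  simp only [rank] at h
  by_contra! hi
  have h1 : j * m < n * m := Nat.mul_lt_mul_of_pos_right hj hm
  have h2 : m * n ≤ i * n := Nat.mul_le_mul_right n hi
  have h3 : i * n ≤ j * m := by zify; linarith
  rw [Nat.mul_comm n m] at h1
  omega

lemma rank_add_prefRank_true (Q : Path) :
    rank m n i j + prefRank m n (true :: Q) = rank m n i (j + 1) + prefRank m n Q := by
  simp [rank, prefRank]; ring

lemma rank_add_prefRank_false (Q : Path) :
    rank m n i j + prefRank m n (false :: Q) = rank m n (i + 1) j + prefRank m n Q := by
  simp [rank, prefRank]; ring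

lemma forall_le_length_take_cons {α : Type*} (C : List α → Prop) (x : α) (w : List α) :
    (∀ k ≤ (x :: w).length, C ((x :: w).take k)) ↔
      C [] ∧ ∀ k ≤ w.length, C (x :: w.take k) := by
  constructor
  · intro h
    exact ⟨by simpa using h 0 (Nat.zero_le _),
      fun k hk => by simpa using h (k + 1) (by simpa using hk)⟩
  · rintro ⟨h0, h1⟩ (_ | k) hk
    · simpa using h0
    · simpa using h1 k (by simpa using hk)

lemma isDyckFrom_true_cons (w : Path) :
    IsDyckFrom m n i j (true :: w) ↔ 0 ≤ rank m n i j ∧ IsDyckFrom m n i (j + 1) w := by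
  unfold IsDyckFrom
  rw [forall_le_length_take_cons (fun Q => 0 ≤ rank m n i j + prefRank m n Q)]
  simp only [rank_add_prefRank_true]
  simp [prefRank, Nat.add_assoc, Nat.add_comm 1]
  tauto

lemma isDyckFrom_false_cons (w : Path) :
    IsDyckFrom m n i j (false :: w) ↔ 0 ≤ rank m n i j ∧ IsDyckFrom m n (i + 1) j w := by
  unfold IsDyckFrom
  rw [forall_le_length_take_cons (fun Q => 0 ≤ rank m n i j + prefRank m n Q)]
  simp only [rank_add_prefRank_false]
  simp [prefRank, Nat.add_assoc, Nat.add_comm 1]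
  tauto

lemma IsDyckFrom.rank_nonneg {w : Path} (h : IsDyckFrom m n i j w) : 0 ≤ rank m n i j := by
  simpa [prefRank] using h.2.2 0 (Nat.zero_le _)

lemma retFrom_true_cons (w : Path) :
    retFrom m n i j (true :: w) =
      (if rank m n i j < n then 1 else 0) + retFrom m n i (j + 1) w := by
  simp only [retFrom, List.length_cons, List.range_succ_eq_map, List.filter_cons,
    List.filter_map, List.take_zero]
  simp only [Function.comp_def, List.take_succ_cons, rank_add_prefRank_true]
  by_cases h : rank m n i j < n <;> simp [h, prefRank, Nat.add_comm]

lemma retFrom_false_cons (w : Path) :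
    retFrom m n i j (false :: w) =
      (if rank m n i j < n then 1 else 0) + retFrom m n (i + 1) j w := by
  simp only [retFrom, List.length_cons, List.range_succ_eq_map, List.filter_cons,
    List.filter_map, List.take_zero]
  simp only [Function.comp_def, List.take_succ_cons, rank_add_prefRank_false]
  by_cases h : rank m n i j < n <;> simp [h, prefRank, Nat.add_comm]

end Rank

section Run

lemma coarea_true_cons (w : Path) : coarea (true :: w) = 0 :: coarea w := by
  simp only [coarea, List.length_cons, List.range_succ_eq_map, List.filterMap_cons,
    List.filterMap_map]
  simp

lemma coarea_false_cons (w : Path) : coarea (false :: w) = (coarea w).map (· + 1) := by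
  simp only [coarea, List.length_cons, List.range_succ_eq_map, List.filterMap_cons,
    List.filterMap_map, List.map_filterMap]
  simp

lemma runFrom_spec (w : Path) :
    ((∀ i < runFrom true w, i ∈ coarea w) ∧ runFrom true w ∉ coarea w) ∧
      (∀ i < runFrom false w, i + 1 ∈ coarea w) ∧ runFrom false w + 1 ∉ coarea w := by
  induction w with
  | nil => simp [runFrom, coarea]
  | cons x w ih =>
    obtain ⟨⟨h1, h2⟩, h3, h4⟩ := ih
    cases x
    · simp only [runFrom, coarea_false_cons]
      simpa using ⟨h1, h2⟩
    · simp only [runFrom, coarea_true_cons]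
      refine ⟨⟨?_, by simpa using h4⟩, fun i hi => by simpa using h3 i hi, by simpa using h4⟩
      rintro (_ | i) hi
      · simp
      · simpa using h3 i (by omega)

lemma runFrom_le_count (w : Path) (b : Bool) : runFrom b w ≤ w.count true := by
  induction w generalizing b with
  | nil => simp [runFrom]
  | cons x w ih =>
    have h1 := ih true
    have h2 := ih false
    cases x <;> cases b <;> simp [runFrom] <;> omega

lemma runFrom_replicate_false (L : ℕ) (b : Bool) : runFrom b (List.replicate L false) = 0 := by
  rcases L with _ | _ | L <;> cases b <;> simp [runFrom, List.replicate_succ]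

lemma runStat_true_cons (w : Path) : runStat (true :: w) = runFrom true (true :: w) := by
  obtain ⟨⟨h1, h2⟩, -⟩ := runFrom_spec (true :: w)
  have hle := runFrom_le_count (true :: w) true
  have hmem : runFrom true (true :: w) ∈
      {i : ℕ | 1 ≤ i ∧ i ≤ (true :: w).count true ∧ i ∉ coarea (true :: w)} :=
    ⟨by simp [runFrom], hle, h2⟩
  refine le_antisymm (Nat.sInf_le hmem) (le_csInf ⟨_, hmem⟩ ?_)
  rintro k ⟨-, -, hk⟩
  by_contra! hlt
  exact hk (h1 k hlt)

end Run

section GeneratingFunction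

variable {R : Type*} [CommRing R] {m n i j L : ℕ} {p q : R} {f : Path → ℕ}

lemma sum_ofFn_succ (g : Path → R) :
    ∑ w : Fin (L + 1) → Bool, g (List.ofFn w) =
      ∑ w : Fin L → Bool, g (true :: List.ofFn w) +
        ∑ w : Fin L → Bool, g (false :: List.ofFn w) := by
  rw [← (Fin.consEquiv fun _ : Fin (L + 1) => Bool).sum_comp, Fintype.sum_prod_type]
  simp [Fin.consEquiv]

/-- The generating function of the paths of length `L` from `(i, j)` to `(m, n)`, where `p`
marks the statistic `f` and `q` marks the points of rank less than `n`. -/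
noncomputable def gf (m n : ℕ) (p q : R) (f : Path → ℕ) (L i j : ℕ) : R :=
  ∑ w : Fin L → Bool, if IsDyckFrom m n i j (List.ofFn w) then
    p ^ f (List.ofFn w) * q ^ retFrom m n i j (List.ofFn w) else 0

lemma gf_of_rank_neg (h : rank m n i j < 0) : gf m n p q f L i j = 0 :=
  Finset.sum_eq_zero fun _ _ => if_neg fun hw => h.not_ge hw.rank_nonneg

lemma gf_of_lt (h : n < j) : gf m n p q f L i j = 0 :=
  Finset.sum_eq_zero fun _ _ => if_neg fun hw => by have := hw.2.1; omega

lemma gf_succ (h : 0 ≤ rank m n i j) :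
    gf m n p q f (L + 1) i j = (if rank m n i j < n then q else 1) *
      (gf m n p q (fun w => f (true :: w)) L i (j + 1) +
        gf m n p q (fun w => f (false :: w)) L (i + 1) j) := by
  unfold gf
  rw [sum_ofFn_succ (fun w => if IsDyckFrom m n i j w then
    p ^ f w * q ^ retFrom m n i j w else 0), mul_add, Finset.mul_sum, Finset.mul_sum]
  simp only [isDyckFrom_true_cons, isDyckFrom_false_cons, retFrom_true_cons,
    retFrom_false_cons, h, true_and]
  congr 1 <;> refine Finset.sum_congr rfl fun w _ => ?_ <;> split_ifs <;> ring

lemma gf_succ_of_le (h : (n : ℤ) ≤ rank m n i j) :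
    gf m n p q f (L + 1) i j = gf m n p q (fun w => f (true :: w)) L i (j + 1) +
      gf m n p q (fun w => f (false :: w)) L (i + 1) j := by
  rw [gf_succ (by omega), if_neg (by omega), one_mul]

lemma gf_succ_of_lt (h : 0 ≤ rank m n i j) (h' : rank m n i j < n) :
    gf m n p q f (L + 1) i j = q * gf m n p q (fun w => f (true :: w)) L i (j + 1) := by
  have hneg : rank m n (i + 1) j < 0 := by rw [rank_succ_left]; omega
  rw [gf_succ h, if_pos h', gf_of_rank_neg hneg, add_zero]

lemma gf_add_one : gf m n p q (fun w => f w + 1) L i j = p * gf m n p q f L i j := by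
  unfold gf
  rw [Finset.mul_sum]
  refine Finset.sum_congr rfl fun w _ => ?_
  split_ifs <;> ring

lemma gf_top (hL : i + L = m) (hf : f (List.replicate L false) = 0) :
    gf m n p q f L i n = 1 := by
  induction L generalizing i f with
  | zero =>
    have hi : i = m := by omega
    subst hi
    have hd : IsDyckFrom i n i n [] := by
      simp [IsDyckFrom, rank, prefRank, mul_comm]
    have hf' : f [] = 0 := hf
    simp [gf, hd, hf', retFrom]
  | succ L ih =>
    have h : (n : ℤ) ≤ rank m n i n := by
      subst hL
      have : (0 : ℤ) ≤ L * n := by positivity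
      simp only [rank]; push_cast; linarith
    rw [gf_succ_of_le h, gf_of_lt (Nat.lt_succ_self n), zero_add]
    exact ih (by omega) hf

lemma gf_zero_sub (hn : 0 < n) (hmn : n ≤ m) (hL : i + j + (L + 1) = m + n) (hj : j < n)
    (h : 0 ≤ rank m n i j) :
    gf m n p q (fun _ => 0) (L + 1) i j - q * gf m n p q (fun _ => 0) L i (j + 1) =
      gf m n q p (fun _ => 0) (L + 1) i j - p * gf m n q p (fun _ => 0) L i (j + 1) := by
  induction L generalizing i j with
  | zero =>
    have := lt_of_rank_nonneg hj h (by omega)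
    omega
  | succ L ih =>
    rcases lt_or_ge (rank m n i j) n with hlt | hge
    · rw [gf_succ_of_lt h hlt, gf_succ_of_lt h hlt]; ring
    · have e1 := ih (i := i + 1) (j := j) (by omega) hj (by rw [rank_succ_left]; omega)
      rw [gf_succ_of_le hge, gf_succ_of_le hge]
      rcases Nat.lt_or_ge (j + 1) n with hj' | hj'
      · have hr : (n : ℤ) ≤ rank m n i (j + 1) := by rw [rank_succ_right]; omega
        have e2 := ih (i := i) (j := j + 1) (by omega) hj' (by omega)
        rw [gf_succ_of_le hr, gf_succ_of_le hr] at e2 ⊢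
        linear_combination e1 + e2
      · obtain rfl : n = j + 1 := by omega
        simp only [gf_top (show i + 1 + L = m by omega),
          gf_top (show i + (L + 1) = m by omega)] at e1 ⊢
        linear_combination e1

lemma sub_mul_gf_runFrom (hn : 0 < n) (hmn : n ≤ m) (hL : i + j + (L + 1) = m + n)
    (hj : j < n) (b : Bool) (h : (n : ℤ) ≤ rank m n (if b then i else i + 1) j) :
    (p - q) * gf m n p q (runFrom b) (L + 1) i j =
      p * gf m n q p (fun _ => 0) L (i + 1) j - q * gf m n p q (fun _ => 0) L (i + 1) j := by
  induction L generalizing i j b with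
  | zero =>
    have h0 : (n : ℤ) ≤ rank m n i j := by
      cases b <;> simp [rank_succ_left] at h <;> omega
    have := lt_of_rank_nonneg hj ((Nat.cast_nonneg n).trans h0) (by omega)
    omega
  | succ L ih =>
    have h1 : 0 ≤ rank m n (i + 1) j := by
      cases b <;> simp [rank_succ_left] at h ⊢ <;> omega
    have h0 : (n : ℤ) ≤ rank m n i j := by rw [rank_succ_left] at h1; omega
    have hK : (p - q) * gf m n p q (runFrom false) (L + 1) i (j + 1) =
        p * gf m n q p (fun _ => 0) L (i + 1) (j + 1) -
          q * gf m n p q (fun _ => 0) L (i + 1) (j + 1) := by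
      rcases Nat.lt_or_ge (j + 1) n with hj' | hj'
      · refine ih (by omega) hj' false ?_
        simp only [Bool.false_eq_true, if_false, rank_succ_right]
        omega
      · obtain rfl : n = j + 1 := by omega
        rw [gf_top (by omega) (runFrom_replicate_false _ _), gf_top (by omega) rfl,
          gf_top (by omega) rfl]
        ring
    rw [gf_succ_of_le h0]
    cases b
    · have h2 : (n : ℤ) ≤ rank m n (i + 1) j := by simpa using h
      have hH := ih (i := i + 1) (by omega) hj true (by simpa using h)
      simp only [runFrom]
      rw [gf_succ_of_le (f := fun _ => 0) h2, gf_succ_of_le (f := fun _ => 0) h2]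
      linear_combination hK + hH
    · simp only [runFrom, gf_add_one]
      have hA := gf_zero_sub (p := p) (q := q) hn hmn (by omega) hj h1 (L := L)
      linear_combination p * hK + p * hA

lemma sub_mul_gf_runFrom_comm (hn : 0 < n) (hmn : n ≤ m) (hL : i + j + L = m + n)
    (hj : j ≤ n) (b : Bool) (h : (if b then 0 else (n : ℤ)) ≤ rank m n i j ∨ j = n) :
    (p - q) * gf m n p q (runFrom b) L i j = (p - q) * gf m n q p (runFrom b) L i j := by
  induction L generalizing i j b with
  | zero =>
    rcases hj.eq_or_lt with rfl | hj
    · rw [gf_top (by omega) (runFrom_replicate_false _ _),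
        gf_top (by omega) (runFrom_replicate_false _ _)]
    · have h0 : 0 ≤ rank m n i j := by
        cases b <;> simp at h <;> omega
      have := lt_of_rank_nonneg hj h0 (by omega)
      omega
  | succ L ih =>
    rcases hj.eq_or_lt with rfl | hj
    · rw [gf_top (by omega) (runFrom_replicate_false _ _),
        gf_top (by omega) (runFrom_replicate_false _ _)]
    · replace h := h.resolve_right hj.ne
      have h0 : 0 ≤ rank m n i j := by
        cases b <;> simp at h <;> omega
      have hK := ih (i := i) (j := j + 1) (by omega) hj false
        (by left; simp only [rank_succ_right, Bool.false_eq_true, if_false]; omega)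
      cases b
      · have h1 : (n : ℤ) ≤ rank m n i j := by simpa using h
        have hH := ih (i := i + 1) (j := j) (by omega) hj.le true
          (by left; simp only [rank_succ_left, if_true]; omega)
        rw [gf_succ_of_le h1, gf_succ_of_le h1]
        simp only [runFrom]
        linear_combination hK + hH
      · rcases lt_or_ge (rank m n i j) n with hlt | hge
        · rw [gf_succ_of_lt h0 hlt, gf_succ_of_lt h0 hlt]
          simp only [runFrom, gf_add_one]
          linear_combination p * q * hK
        · have e1 := sub_mul_gf_runFrom (p := p) (q := q) hn hmn hL hj true (by simpa using hge)
          have e2 := sub_mul_gf_runFrom (p := q) (q := p) hn hmn hL hj true (by simpa using hge)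
          linear_combination e1 + e2

lemma sum_dyckPaths (hn : 0 < n) :
    ∑ P ∈ dyckPaths m n, p ^ runStat P * q ^ retStat m n P =
      gf m n p q (runFrom true) (m + n) 0 0 := by
  have hdyck (P : Path) : IsDyck m n P ↔ IsDyckFrom m n 0 0 P := by
    simp [IsDyck, IsDyckFrom, rank]
  have hret (P : Path) : retStat m n P = retFrom m n 0 0 P := by
    simp [retStat, retFrom, rank]
  have hrun (P : Path) (hP : IsDyckFrom m n 0 0 P) : runStat P = runFrom true P := by
    match P with
    | [] => have := hP.2.1; simp at this; omega
    | true :: w => exact runStat_true_cons w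
    | false :: w =>
      have := ((isDyckFrom_false_cons w).1 hP).2.rank_nonneg
      simp [rank] at this
      omega
  rw [dyckPaths, Finset.sum_filter, Finset.sum_image List.ofFn_injective.injOn]
  refine Finset.sum_congr rfl fun w _ => ?_
  simp only [hdyck, hret]
  split_ifs with h
  · rw [hrun _ h]
  · rfl

end GeneratingFunction

open MvPolynomial in
/-- For `m > n`, the joint distribution of `(run, ret)` on `D_{m,n}` is
symmetric, as an identity of polynomials in `p = X 0` and `q = X 1`. -/
theorem run_ret_symmetric (m n : ℕ) (hn : 0 < n) (hmn : n < m) :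
    (∑ P ∈ dyckPaths m n,
        (X 0 : MvPolynomial (Fin 2) ℚ) ^ runStat P * (X 1) ^ retStat m n P) =
      ∑ P ∈ dyckPaths m n,
        (X 0 : MvPolynomial (Fin 2) ℚ) ^ retStat m n P * (X 1) ^ runStat P := by
  have hswap : ∑ P ∈ dyckPaths m n,
      (X 0 : MvPolynomial (Fin 2) ℚ) ^ retStat m n P * (X 1) ^ runStat P =
        ∑ P ∈ dyckPaths m n, (X 1) ^ runStat P * (X 0) ^ retStat m n P :=
    Finset.sum_congr rfl fun _ _ => mul_comm _ _
  rw [hswap, sum_dyckPaths hn, sum_dyckPaths hn]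
  refine mul_left_cancel₀ ?_ (sub_mul_gf_runFrom_comm hn hmn.le (by omega) hn.le true
    (Or.inl (by simp [rank])))
  exact sub_ne_zero.2 fun h => absurd (X_injective h) (by decide)

end RationalDyck
end

section
/- Let m, n, k, ℓ be positive integers with ⌊m/n⌋ ≥ 2. Then the sets D_{m,n}^{(k,ℓ)} and D_{m,n}^{(k+ℓ−1, 1)} have the same cardinality. -/
open scoped Classical

namespace RationalDyck

/-- The number of paths of length `L` satisfying `p`. -/
noncomputable def countPaths : ℕ → (Path → Prop) → ℕ
  | 0, p => if p [] then 1 else 0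
  | L + 1, p => countPaths L (fun R => p (true :: R)) + countPaths L (fun R => p (false :: R))

/-- `R`, started at a point of rank `r`, stays at nonnegative rank, ends at rank `0`, and
visits exactly `l` points of rank less than `n` before its endpoint. -/
def ValidFrom (m n : ℕ) : ℤ → Path → ℕ → Prop
  | r, [], l => r = 0 ∧ l = 0
  | r, true :: R, l =>
    if r < n then 0 ≤ r ∧ ∃ l', l = l' + 1 ∧ ValidFrom m n (r + m) R l'
    else ValidFrom m n (r + m) R l
  | r, false :: R, l => n ≤ r ∧ ValidFrom m n (r - n) R l

/-- Columns `1, …, k` of `R` all contain a north step. -/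
def CoversPos (k : ℕ) (R : Path) : Prop := ∀ i, 1 ≤ i → i ≤ k → i ∈ coarea R

/-- Columns `0, …, k - 1` of `R` all contain a north step. -/
def Covers (k : ℕ) (R : Path) : Prop := ∀ i < k, i ∈ coarea R

theorem coarea_cons_true (R : Path) : coarea (true :: R) = 0 :: coarea R := by
  simp [coarea, List.range_succ_eq_map, List.filterMap_map]

theorem coarea_cons_false (R : Path) : coarea (false :: R) = (coarea R).map (· + 1) := by
  simp only [coarea, List.length_cons, List.range_succ_eq_map, List.map_filterMap]
  simp only [List.filterMap_cons, List.filterMap_map, Function.comp_def]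
  simp

theorem length_coarea (R : Path) : (coarea R).length = R.count true := by
  induction R with
  | nil => rfl
  | cons a R ih => cases a <;> simp [coarea_cons_true, coarea_cons_false, ih]

theorem coversPos_cons_true (k : ℕ) (R : Path) :
    CoversPos k (true :: R) ↔ CoversPos k R := by
  simp only [CoversPos, coarea_cons_true, List.mem_cons]
  refine forall_congr' fun i => forall_congr' fun hi => ?_
  simp [show i ≠ 0 by omega]

theorem coversPos_cons_false (k : ℕ) (R : Path) :
    CoversPos k (false :: R) ↔ Covers k R := by
  simp only [CoversPos, Covers, coarea_cons_false, List.mem_map]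
  constructor
  · intro h i hi
    obtain ⟨j, hj, e⟩ := h (i + 1) (by omega) (by omega)
    rwa [← Nat.succ_injective e]
  · intro h i h1 h2
    exact ⟨i - 1, h _ (by omega), by omega⟩

theorem covers_succ_cons_true (k : ℕ) (R : Path) :
    Covers (k + 1) (true :: R) ↔ CoversPos k R := by
  simp only [CoversPos, Covers, coarea_cons_true, List.mem_cons]
  constructor
  · intro h i h1 h2
    exact (h i (by omega)).resolve_left (by omega)
  · intro h i hi
    rcases Nat.eq_zero_or_pos i with h0 | h0
    · exact .inl h0
    · exact .inr (h i h0 (by omega))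

theorem not_covers_succ_cons_false (k : ℕ) (R : Path) : ¬ Covers (k + 1) (false :: R) := by
  intro h
  simpa [coarea_cons_false] using h 0 (by omega)

theorem covers_zero (R : Path) : Covers 0 R := fun _ h => absurd h (by omega)

theorem countPaths_succ (L : ℕ) (p : Path → Prop) :
    countPaths (L + 1) p =
      countPaths L (fun R => p (true :: R)) + countPaths L (fun R => p (false :: R)) := rfl

theorem countPaths_congr {L : ℕ} {p q : Path → Prop} (h : ∀ R, p R ↔ q R) :
    countPaths L p = countPaths L q := by
  rw [show p = q from funext fun R => propext (h R)]

theorem countPaths_false (L : ℕ) : countPaths L (fun _ => False) = 0 := by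
  induction L with
  | zero => simp [countPaths]
  | succ L ih => simp [countPaths, ih]

theorem countPaths_and_not_add (L : ℕ) (p q : Path → Prop) (h : ∀ R, q R → p R) :
    countPaths L (fun R => p R ∧ ¬ q R) + countPaths L q = countPaths L p := by
  induction L generalizing p q with
  | zero =>
    have := h []
    by_cases hp : p [] <;> by_cases hq : q [] <;> simp_all [countPaths]
  | succ L ih =>
    have h1 := ih (fun R => p (true :: R)) (fun R => q (true :: R)) fun R => h _
    have h2 := ih (fun R => p (false :: R)) (fun R => q (false :: R)) fun R => h _
    simp only [countPaths]
    omega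

theorem card_filter_ofFn (L : ℕ) (p : Path → Prop) :
    (((Finset.univ : Finset (Fin L → Bool)).image List.ofFn).filter p).card =
      countPaths L p := by
  induction L generalizing p with
  | zero => by_cases h : p [] <;> simp [countPaths, Finset.filter_singleton, h]
  | succ L ih =>
    have hsplit : (Finset.univ.image (List.ofFn : (Fin (L + 1) → Bool) → Path)).filter p =
        ((Finset.univ.image (List.ofFn : (Fin L → Bool) → Path)).filter
          fun R => p (true :: R)).image (List.cons true) ∪
        ((Finset.univ.image (List.ofFn : (Fin L → Bool) → Path)).filter
          fun R => p (false :: R)).image (List.cons false) := by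
      ext R
      simp only [Finset.mem_filter, Finset.mem_image, Finset.mem_univ, true_and,
        Finset.mem_union]
      constructor
      · rintro ⟨⟨f, rfl⟩, h⟩
        rw [List.ofFn_succ] at h ⊢
        cases hf : f 0 <;> rw [hf] at h
        · exact .inr ⟨_, ⟨⟨_, rfl⟩, h⟩, rfl⟩
        · exact .inl ⟨_, ⟨⟨_, rfl⟩, h⟩, rfl⟩
      · rintro (⟨_, ⟨⟨f, rfl⟩, h⟩, rfl⟩ | ⟨_, ⟨⟨f, rfl⟩, h⟩, rfl⟩)
        · exact ⟨⟨Fin.cons true f, by simp [List.ofFn_succ]⟩, h⟩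
        · exact ⟨⟨Fin.cons false f, by simp [List.ofFn_succ]⟩, h⟩
    rw [hsplit, Finset.card_union_of_disjoint, Finset.card_image_of_injective _ List.cons_injective,
      Finset.card_image_of_injective _ List.cons_injective, ih, ih, countPaths]
    rw [Finset.disjoint_left]
    intro R h1 h2
    obtain ⟨_, _, rfl⟩ := Finset.mem_image.1 h1
    obtain ⟨_, _, h⟩ := Finset.mem_image.1 h2
    simp at h

section Validity

variable {m n : ℕ}

theorem validFrom_cons_true_of_le {r : ℤ} (h : (n : ℤ) ≤ r) (R : Path) (l : ℕ) :
    ValidFrom m n r (true :: R) l ↔ ValidFrom m n (r + m) R l := by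
  rw [ValidFrom, if_neg (by omega)]

theorem validFrom_cons_true_of_lt {r : ℤ} (h0 : 0 ≤ r) (h : r < n) (R : Path) (l : ℕ) :
    ValidFrom m n r (true :: R) (l + 1) ↔ ValidFrom m n (r + m) R l := by
  rw [ValidFrom, if_pos h]
  simp [h0]

theorem validFrom_cons_false_of_le {r : ℤ} (h : (n : ℤ) ≤ r) (R : Path) (l : ℕ) :
    ValidFrom m n r (false :: R) l ↔ ValidFrom m n (r - n) R l := by
  simp [ValidFrom, h]

theorem validFrom_cons_false_of_lt {r : ℤ} (h : r < n) (R : Path) (l : ℕ) :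
    ValidFrom m n r (false :: R) l ↔ False := by
  simp [ValidFrom, h]

theorem countPaths_validFrom_succ (hm : 0 < m) (L : ℕ) (r : ℤ) (hr : 0 ≤ r) (l : ℕ) :
    countPaths (L + 1) (fun R => ValidFrom m n r R (l + 1)) =
      countPaths L (fun R => ValidFrom m n (r + m) R l) := by
  induction L generalizing r with
  | zero =>
    rcases lt_or_ge r n with h | h
    · rw [countPaths_succ]
      simp only [validFrom_cons_true_of_lt hr h, validFrom_cons_false_of_lt h,
        countPaths_false, add_zero]
    · rw [countPaths_succ]
      simp only [validFrom_cons_true_of_le h, validFrom_cons_false_of_le h]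
      simp [countPaths, ValidFrom, show r + m ≠ 0 by omega]
  | succ L ih =>
    rw [countPaths_succ]
    rcases lt_or_ge r n with h | h
    · simp only [validFrom_cons_true_of_lt hr h, validFrom_cons_false_of_lt h,
        countPaths_false, add_zero]
    · simp only [validFrom_cons_true_of_le h, validFrom_cons_false_of_le h]
      have h' : (n : ℤ) ≤ r + m := by omega
      rw [ih _ (by omega), ih _ (by omega), countPaths]
      simp only [validFrom_cons_true_of_le h', validFrom_cons_false_of_le h']
      rw [show r - n + m = r + m - n by ring]

theorem countPaths_covers_and_coversPos (hn : 0 < n) (hmn : n ≤ m) (L : ℕ) :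
    (∀ (r : ℤ) (k l : ℕ), (n : ℤ) ≤ r →
      countPaths L (fun R => ValidFrom m n r R (l + 1) ∧ Covers k R) =
        countPaths L (fun R => ValidFrom m n r R l ∧ Covers (k + 1) R)) ∧
    (∀ (r : ℤ) (k l : ℕ), (2 * n : ℤ) ≤ r →
      countPaths L (fun R => ValidFrom m n r R (l + 1) ∧ CoversPos k R) =
        countPaths L (fun R => ValidFrom m n r R l ∧ CoversPos (k + 1) R)) := by
  induction L with
  | zero =>
    refine ⟨fun r k l hr => ?_, fun r k l hr => ?_⟩ <;>
      simp [countPaths, ValidFrom, show r ≠ 0 by omega]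
  | succ L ih =>
    refine ⟨fun r k l hr => ?_, fun r k l hr => ?_⟩
    · cases k with
      | zero =>
        simp only [covers_zero, and_true]
        rw [countPaths_validFrom_succ (by omega) _ _ (by omega), countPaths]
        simp only [covers_succ_cons_true, not_covers_succ_cons_false, and_false,
          countPaths_false, add_zero, validFrom_cons_true_of_le hr]
        refine countPaths_congr fun R => (and_iff_left ?_).symm
        intro i h1 h2
        omega
      | succ k =>
        simp only [countPaths, covers_succ_cons_true, not_covers_succ_cons_false, and_false,
          countPaths_false, add_zero, validFrom_cons_true_of_le hr]
        exact ih.2 _ _ _ (by omega)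
    · have hr' : (n : ℤ) ≤ r := by omega
      simp only [countPaths, coversPos_cons_true, coversPos_cons_false,
        validFrom_cons_true_of_le hr', validFrom_cons_false_of_le hr']
      rw [ih.2 _ _ _ (by omega), ih.1 _ _ _ (by omega)]

theorem countPaths_validFrom_zero_coversPos (hn : 0 < n) (hmn : 2 * n ≤ m) (L k l : ℕ) :
    countPaths (L + 1) (fun R => ValidFrom m n 0 R (l + 2) ∧ CoversPos k R) =
      countPaths (L + 1) (fun R => ValidFrom m n 0 R (l + 1) ∧ CoversPos (k + 1) R) := by
  have h0 : (0 : ℤ) < n := by omega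
  simp only [countPaths, coversPos_cons_true, validFrom_cons_true_of_lt le_rfl h0,
    validFrom_cons_false_of_lt h0, false_and, countPaths_false, add_zero]
  exact (countPaths_covers_and_coversPos hn (by omega) L).2 _ _ _ (by omega)

theorem prefRank_cons_true (R : Path) : prefRank m n (true :: R) = m + prefRank m n R := by
  simp [prefRank]
  ring

theorem prefRank_cons_false (R : Path) : prefRank m n (false :: R) = prefRank m n R - n := by
  simp [prefRank]
  ring

theorem validFrom_iff (r : ℤ) (R : Path) (l : ℕ) :
    ValidFrom m n r R l ↔ (∀ i ≤ R.length, 0 ≤ r + prefRank m n (R.take i)) ∧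
      r + prefRank m n R = 0 ∧
      ((List.range R.length).filter fun i => r + prefRank m n (R.take i) < (n : ℤ)).length
        = l := by
  have forall_le_succ (N : ℕ) (p : ℕ → Prop) :
      (∀ i ≤ N + 1, p i) ↔ p 0 ∧ ∀ i ≤ N, p (i + 1) := by
    refine ⟨fun h => ⟨h 0 (by omega), fun i hi => h _ (by omega)⟩, fun h i hi => ?_⟩
    cases i with
    | zero => exact h.1
    | succ i => exact h.2 i (by omega)
  induction R generalizing r l with
  | nil =>
    simp [ValidFrom, prefRank]
    omega
  | cons a R ih =>
    have hnil : prefRank m n [] = 0 := by simp [prefRank]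
    cases a with
    | true =>
      simp only [ValidFrom, ih, List.length_cons, forall_le_succ, List.range_succ_eq_map,
        List.filter_cons, List.filter_map, Function.comp_def, List.take_zero,
        List.take_succ_cons, prefRank_cons_true, hnil, add_zero, ← add_assoc]
      by_cases h : r < n
      · simp [h]
        constructor
        · rintro ⟨h0, h3, h1, h2⟩
          exact ⟨⟨h0, h1⟩, h2, h3.symm⟩
        · rintro ⟨⟨h0, h1⟩, h2, h3⟩
          exact ⟨h0, h3.symm, h1, h2⟩
      · simp [h]
        omega
    | false =>
      simp only [ValidFrom, ih, List.length_cons, forall_le_succ, List.range_succ_eq_map,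
        List.filter_cons, List.filter_map, Function.comp_def, List.take_zero,
        List.take_succ_cons, prefRank_cons_false, hnil, add_zero, ← add_sub_assoc,
        sub_add_eq_add_sub]
      by_cases h : r < n
      · simp only [show ¬ (n : ℤ) ≤ r by omega, false_and, false_iff]
        rintro ⟨⟨-, h1⟩, -⟩
        have := h1 0 (by omega)
        simp [hnil] at this
        omega
      · rw [if_neg (by simpa using h)]
        simp [not_lt.1 h, show 0 ≤ r by omega]

theorem isDyck_and_retStat_iff (hm : 0 < m) {P : Path} (hP : P.length = m + n) (l : ℕ) :
    IsDyck m n P ∧ retStat m n P = l ↔ ValidFrom m n 0 P l := by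
  have hlen := List.count_true_add_count_false P
  have key : prefRank m n P = 0 ↔ P.count false = m ∧ P.count true = n := by
    simp only [prefRank]
    constructor
    · intro h
      have e : (P.count true : ℤ) = n := by
        have hf : (P.count false : ℤ) = m + n - P.count true := by omega
        rw [hf] at h
        have : ((m : ℤ) + n) * (P.count true - n) = 0 := by linear_combination h
        rcases mul_eq_zero.1 this with h | h <;> omega
      omega
    · rintro ⟨h1, h2⟩
      rw [h1, h2]
      ring
  simp only [validFrom_iff, zero_add, key, IsDyck, retStat]
  tauto

end Validity

theorem runStat_eq_succ_iff {P : Path} (h0 : 0 ∈ coarea P) (k : ℕ) :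
    runStat P = k + 1 ↔ CoversPos k P ∧ ¬ CoversPos (k + 1) P := by
  have key {S : Set ℕ} {a : ℕ} : sInf S = a + 1 ↔ a + 1 ∈ S ∧ ∀ i ∈ S, a + 1 ≤ i := by
    constructor
    · intro h
      have hne : S.Nonempty := Nat.nonempty_of_pos_sInf (by omega)
      exact ⟨h ▸ Nat.sInf_mem hne, fun i hi => h ▸ Nat.sInf_le hi⟩
    · rintro ⟨h1, h2⟩
      exact le_antisymm (Nat.sInf_le h1) (h2 _ (Nat.sInf_mem ⟨_, h1⟩))
  rw [runStat, key]
  simp only [Set.mem_ofPred_eq]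
  constructor
  · rintro ⟨⟨-, h1, h2⟩, h3⟩
    refine ⟨fun i hi hik => ?_, fun h => h2 (h _ (by omega) le_rfl)⟩
    by_contra h
    have := h3 i ⟨hi, by omega, h⟩
    omega
  · rintro ⟨h1, h2⟩
    have hk : k + 1 ≤ P.count true := by
      rw [← length_coarea]
      have hsub : Finset.range (k + 1) ⊆ (coarea P).toFinset := by
        intro i hi
        rw [List.mem_toFinset]
        rcases Nat.eq_zero_or_pos i with rfl | hi0
        · exact h0
        · exact h1 i hi0 (by simpa [Nat.lt_succ_iff] using hi)
      simpa using (Finset.card_le_card hsub).trans (List.toFinset_card_le _)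
    refine ⟨⟨by omega, hk, fun h => h2 fun i hi hik => ?_⟩, ?_⟩
    · rcases Nat.lt_or_ge k i with hlt | hge
      · rwa [show i = k + 1 by omega]
      · exact h1 i hi hge
    · rintro i ⟨hi, -, hni⟩
      by_contra hlt
      exact hni (h1 i hi (by omega))

theorem zero_mem_coarea_of_validFrom {m n : ℕ} (hn : 0 < n) {P : Path} (hP : P ≠ []) {l : ℕ}
    (h : ValidFrom m n 0 P l) : 0 ∈ coarea P := by
  match P with
  | true :: R => simp [coarea_cons_true]
  | false :: R =>
    have := h.1
    omega

theorem card_dyckPathsRR_succ {m n : ℕ} (hm : 0 < m) (hn : 0 < n) (k l : ℕ) :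
    (dyckPathsRR m n (k + 1) l).card = countPaths (m + n) (fun P =>
      (ValidFrom m n 0 P l ∧ CoversPos k P) ∧
        ¬ (ValidFrom m n 0 P l ∧ CoversPos (k + 1) P)) := by
  rw [← card_filter_ofFn, dyckPathsRR, dyckPaths, Finset.filter_filter]
  apply congrArg
  ext P
  simp only [Finset.mem_filter]
  refine and_congr_right fun hP => ?_
  have hlen : P.length = m + n := by
    obtain ⟨f, -, rfl⟩ := Finset.mem_image.1 hP
    simp
  have hv := isDyck_and_retStat_iff hm hlen l
  have hne : P ≠ [] := by
    rintro rfl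
    simp at hlen
    omega
  by_cases h : ValidFrom m n 0 P l
  · have hr := runStat_eq_succ_iff (zero_mem_coarea_of_validFrom hn hne h) k
    tauto
  · tauto

theorem card_dyckPathsRR_step {m n : ℕ} (hn : 0 < n) (hmn : 2 * n ≤ m) (k l : ℕ) :
    (dyckPathsRR m n (k + 1) (l + 2)).card = (dyckPathsRR m n (k + 2) (l + 1)).card := by
  have hm : 0 < m := by omega
  have mono (k l : ℕ) (P : Path) (h : ValidFrom m n 0 P l ∧ CoversPos (k + 1) P) :
      ValidFrom m n 0 P l ∧ CoversPos k P :=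
    ⟨h.1, fun i h1 h2 => h.2 i h1 (by omega)⟩
  have h1 := countPaths_and_not_add (m + n) _ _ (mono k (l + 2))
  have h2 := countPaths_and_not_add (m + n) _ _ (mono (k + 1) (l + 1))
  have e (k : ℕ) := countPaths_validFrom_zero_coversPos hn hmn (m + n - 1) k l
  rw [show m + n - 1 + 1 = m + n by omega] at e
  have e1 := e k
  have e2 := e (k + 1)
  rw [card_dyckPathsRR_succ hm hn, card_dyckPathsRR_succ hm hn]
  omega

/-- If `⌊m/n⌋ ≥ 2` then `|D_{m,n}^{(k,ℓ)}| = |D_{m,n}^{(k+ℓ-1,1)}|`. -/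
theorem card_run_ret_shift (m n k l : ℕ) (hm : 0 < m) (hn : 0 < n)
    (hk : 0 < k) (hl : 0 < l) (h : 2 ≤ m / n) :
    (dyckPathsRR m n k l).card = (dyckPathsRR m n (k + l - 1) 1).card := by
  have hmn : 2 * n ≤ m := (Nat.le_div_iff_mul_le hn).1 h
  obtain ⟨k, rfl⟩ : ∃ k', k = k' + 1 := ⟨k - 1, by omega⟩
  obtain ⟨l, rfl⟩ : ∃ l', l = l' + 1 := ⟨l - 1, by omega⟩
  clear hk hl
  induction l generalizing k with
  | zero => rfl
  | succ l ih =>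
    rw [card_dyckPathsRR_step hn hmn, ih (k + 1)]
    congr 2
    omega

end RationalDyck
end
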